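/- Define ψ(x,y,z,v,w,s,t) = xy² + sv² + (z − yw − vt)² on ℂ⁷. At every point with y ≠ 0 and v ≠ 0, the Hessian D²ψ has rank exactly 5. -/

import Mathlib

/-- The Hessian matrix of second (complex) partial derivatives of `ψ` at `ξ`. -/
noncomputable def hess {n : ℕ} (ψ : (Fin n → ℂ) → ℂ) (ξ : Fin n → ℂ) :
    Matrix (Fin n) (Fin n) ℂ :=
  Matrix.of fun i j => fderiv ℂ (fun η => fderiv ℂ ψ η (Pi.single j 1)) ξ (Pi.single i 1)

/-- `ψ(x,y,z,v,w,s,t) = xy² + sv² + (z − yw − vt)²` in coordinates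
`(x,y,z,v,w,s,t) = (ξ 0, ξ 1, ξ 2, ξ 3, ξ 4, ξ 5, ξ 6)`. -/
noncomputable def ψ (ξ : Fin 7 → ℂ) : ℂ :=
  ξ 0 * (ξ 1) ^ 2 + ξ 5 * (ξ 3) ^ 2 + (ξ 2 - ξ 1 * ξ 4 - ξ 3 * ξ 6) ^ 2

/-- Partial derivatives of `ψ`. -/
theorem fderiv_ψ_single (η : Fin 7 → ℂ) (j : Fin 7) :
    fderiv ℂ ψ η (Pi.single j 1) =
      (![η 1 ^ 2,
        2 * η 0 * η 1 - 2 * η 4 * (η 2 - η 1 * η 4 - η 3 * η 6),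
        2 * (η 2 - η 1 * η 4 - η 3 * η 6),
        2 * η 5 * η 3 - 2 * η 6 * (η 2 - η 1 * η 4 - η 3 * η 6),
        -(2 * η 1 * (η 2 - η 1 * η 4 - η 3 * η 6)),
        η 3 ^ 2,
        -(2 * η 3 * (η 2 - η 1 * η 4 - η 3 * η 6))] : Fin 7 → ℂ) j := by
  have h (i : Fin 7) : HasFDerivAt (fun ξ : Fin 7 → ℂ => ξ i)
      (ContinuousLinearMap.proj (R := ℂ) (φ := fun _ : Fin 7 => ℂ) i) η := hasFDerivAt_apply i η
  have hψ := (((h 0).mul ((h 1).pow 2)).add ((h 5).mul ((h 3).pow 2))).add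
    ((((h 2).sub ((h 1).mul (h 4))).sub ((h 3).mul (h 6))).pow 2)
  have hf : fderiv ℂ ψ η = _ := hψ.fderiv
  rw [hf]
  fin_cases j <;> simp <;> ring

/-- The Hessian of `ψ` in closed form. -/
theorem hess_ψ (ξ : Fin 7 → ℂ) (x y z v w s t u : ℂ) (hξ : ξ = ![x, y, z, v, w, s, t])
    (hu : u = z - y * w - v * t) :
    hess ψ ξ =
      !![0, 2 * y, 0, 0, 0, 0, 0;
        2 * y, 2 * x + 2 * w ^ 2, -(2 * w), 2 * w * t, 2 * w * y - 2 * u, 0, 2 * w * v;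
        0, -(2 * w), 2, -(2 * t), -(2 * y), 0, -(2 * v);
        0, 2 * w * t, -(2 * t), 2 * s + 2 * t ^ 2, 2 * t * y, 2 * v, 2 * t * v - 2 * u;
        0, 2 * w * y - 2 * u, -(2 * y), 2 * t * y, 2 * y ^ 2, 0, 2 * y * v;
        0, 0, 0, 2 * v, 0, 0, 0;
        0, 2 * w * v, -(2 * v), 2 * t * v - 2 * u, 2 * y * v, 0, 2 * v ^ 2] := by
  have h (i : Fin 7) : HasFDerivAt (fun ξ : Fin 7 → ℂ => ξ i)
      (ContinuousLinearMap.proj (R := ℂ) (φ := fun _ : Fin 7 => ℂ) i) ξ := hasFDerivAt_apply i ξ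
  have hU := ((h 2).sub ((h 1).mul (h 4))).sub ((h 3).mul (h 6))
  have h0 := ((h 1).pow 2).fderiv
  have h1 := ((((h 0).const_mul 2).mul (h 1)).sub (((h 4).const_mul 2).mul hU)).fderiv
  have h2 := (hU.const_mul 2).fderiv
  have h3 := ((((h 5).const_mul 2).mul (h 3)).sub (((h 6).const_mul 2).mul hU)).fderiv
  have h4 := (((h 1).const_mul 2).mul hU).neg.fderiv
  have h5 := ((h 3).pow 2).fderiv
  have h6 := (((h 3).const_mul 2).mul hU).neg.fderiv
  have key (i j : Fin 7) : hess ψ ξ i j = fderiv ℂ (fun η => fderiv ℂ ψ η (Pi.single j 1)) ξ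
      (Pi.single i 1) := rfl
  simp only [fderiv_ψ_single] at key
  ext i j
  rw [key]
  fin_cases j
  · refine (DFunLike.congr_fun h0 _).trans ?_
    fin_cases i <;> simp [hξ]
  · refine (DFunLike.congr_fun h1 _).trans ?_
    fin_cases i <;> simp [hξ, hu] <;> ring
  · refine (DFunLike.congr_fun h2 _).trans ?_
    fin_cases i <;> simp [hξ]
  · refine (DFunLike.congr_fun h3 _).trans ?_
    fin_cases i <;> simp [hξ, hu] <;> ring
  · refine (DFunLike.congr_fun h4 _).trans ?_
    fin_cases i <;> simp [hξ, hu] <;> ring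
  · refine (DFunLike.congr_fun h5 _).trans ?_
    fin_cases i <;> simp [hξ]
  · refine (DFunLike.congr_fun h6 _).trans ?_
    fin_cases i <;> simp [hξ, hu] <;> ring

theorem stmt_15 (ξ : Fin 7 → ℂ) (hy : ξ 1 ≠ 0) (hv : ξ 3 ≠ 0) :
    (hess ψ ξ).rank = 5 := by
  obtain ⟨x, y, z, v, w, s, t, hξ⟩ : ∃ x y z v w s t : ℂ, ξ = ![x, y, z, v, w, s, t] :=
    ⟨ξ 0, ξ 1, ξ 2, ξ 3, ξ 4, ξ 5, ξ 6, by ext i; fin_cases i <;> rfl⟩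
  obtain ⟨u, hu⟩ : ∃ u, u = z - y * w - v * t := ⟨_, rfl⟩
  replace hy : y ≠ 0 := by simpa [hξ] using hy
  replace hv : v ≠ 0 := by simpa [hξ] using hv
  have hH := hess_ψ ξ x y z v w s t u hξ hu
  apply le_antisymm
  · -- rows 4 and 6 are combinations of rows 0, 2 and 2, 5 respectively
    have hfac : hess ψ ξ =
        !![1, 0, 0, 0, 0; 0, 1, 0, 0, 0; 0, 0, 1, 0, 0; 0, 0, 0, 1, 0;
          -(u / y), 0, -y, 0, 0; 0, 0, 0, 0, 1; 0, 0, -v, 0, -(u / v)] *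
        (hess ψ ξ).submatrix ![0, 1, 2, 3, 5] id := by
      rw [hH]
      ext i j
      rw [Matrix.mul_apply]
      simp only [Matrix.submatrix_apply, Fin.sum_univ_five]
      fin_cases i <;> fin_cases j <;> simp <;> field_simp <;> ring
    rw [hfac]
    exact (Matrix.rank_mul_le_left _ _).trans (Matrix.rank_le_width _)
  · -- a lower triangular `5 × 5` minor
    have hdet : ((hess ψ ξ).submatrix ![0, 5, 2, 1, 3] ![1, 3, 2, 0, 5]).det ≠ 0 := by
      rw [Matrix.det_of_isLowerTriangular]
      · simp [hH, Fin.prod_univ_succ, hy, hv]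
      · intro i j hij
        replace hij : i < j := hij
        rw [hH]
        fin_cases i <;> fin_cases j <;> first | rfl | simp at hij
    have hrank := Matrix.rank_of_isUnit _ ((Matrix.isUnit_iff_isUnit_det _).2 hdet.isUnit)
    rw [Fintype.card_fin] at hrank
    exact hrank.ge.trans (Matrix.rank_submatrix_le _ _ _)
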